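/- arXiv:1807.08822 — 2 statements merged into one kernel-verified Lean document; each statement's English description precedes it below -/
import Mathlib

section
/- Let r₀ > 0 and T_max > 0. Let T : [0,1] → ℝ be continuously differentiable with ∫₀¹ T'(s)² ds ≤ T_max, and let h, G : [0,1] → ℝ be continuous functions with h(s) > 0 and G(s) ≥ 0 for all s ∈ [0,1]. Then |∫₀¹ √(T'(s)²/h(s)² + G(s)) ds − ∫₀¹ √(T'(s)²·r₀²/4 + G(s)) ds| ≤ √T_max · (∫₀¹ |1/h(s)² − r₀²/4|² ds)^{1/4}. -/
open MeasureTheory Set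

/-- The square root is `1/2`-Hölder with constant one. -/
theorem abs_sqrt_sub_sqrt_le_sqrt_abs_sub {a b : ℝ} (ha : 0 ≤ a) (hb : 0 ≤ b) :
    |Real.sqrt a - Real.sqrt b| ≤ Real.sqrt |a - b| := by
  apply Real.le_sqrt_of_sq_le
  have hab : a - b = (Real.sqrt a - Real.sqrt b) * (Real.sqrt a + Real.sqrt b) := by
    nlinarith [Real.sq_sqrt ha, Real.sq_sqrt hb]
  have hle : |Real.sqrt a - Real.sqrt b| ≤ Real.sqrt a + Real.sqrt b := by
    rw [abs_le]
    constructor <;> linarith [Real.sqrt_nonneg a, Real.sqrt_nonneg b]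
  rw [hab, abs_mul, abs_of_nonneg (add_nonneg (Real.sqrt_nonneg a) (Real.sqrt_nonneg b)), sq]
  exact mul_le_mul_of_nonneg_left hle (abs_nonneg _)

/-- The Cauchy–Schwarz inequality for continuous functions on a compact interval. -/
theorem intervalIntegral_mul_le_sqrt_mul_sqrt {a b : ℝ} (hab : a ≤ b) {f g : ℝ → ℝ}
    (hf : ContinuousOn f (Icc a b)) (hg : ContinuousOn g (Icc a b)) :
    ∫ s in a..b, f s * g s ≤
      Real.sqrt (∫ s in a..b, f s ^ 2) * Real.sqrt (∫ s in a..b, g s ^ 2) := by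
  have hff : IntervalIntegrable (fun s => f s ^ 2) volume a b :=
    (hf.pow 2).intervalIntegrable_of_Icc hab
  have hgg : IntervalIntegrable (fun s => g s ^ 2) volume a b :=
    (hg.pow 2).intervalIntegrable_of_Icc hab
  have hfg : IntervalIntegrable (fun s => f s * g s) volume a b :=
    (hf.mul hg).intervalIntegrable_of_Icc hab
  have hquad : ∀ t : ℝ, 0 ≤ (∫ s in a..b, g s ^ 2) * (t * t) +
      (2 * ∫ s in a..b, f s * g s) * t + ∫ s in a..b, f s ^ 2 := by
    intro t
    have hnonneg : 0 ≤ ∫ s in a..b, (f s + t * g s) ^ 2 :=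
      intervalIntegral.integral_nonneg hab fun s _ => sq_nonneg _
    have hexp : ∫ s in a..b, (f s + t * g s) ^ 2 =
        ∫ s in a..b, (f s ^ 2 + (2 * t) * (f s * g s) + t ^ 2 * g s ^ 2) :=
      intervalIntegral.integral_congr fun s _ => by ring
    rw [hexp, intervalIntegral.integral_add (hff.add (hfg.const_mul _)) (hgg.const_mul _),
      intervalIntegral.integral_add hff (hfg.const_mul _),
      intervalIntegral.integral_const_mul, intervalIntegral.integral_const_mul] at hnonneg
    linarith
  have hdisc := discrim_le_zero hquad
  rw [discrim] at hdisc
  rw [← Real.sqrt_mul (intervalIntegral.integral_nonneg hab fun s _ => sq_nonneg _)]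
  apply Real.le_sqrt_of_sq_le
  linarith

/-- Analytic core of Lemma `IMCF-L`: comparison of lengths of a curve with
respect to two metrics differing only in their `dt²`-coefficients. -/
theorem imcf_length_comparison
    (r₀ Tmax : ℝ) (hr₀ : 0 < r₀) (hTmax : 0 < Tmax)
    (T T' h G : ℝ → ℝ)
    (hT : ∀ s ∈ Icc (0:ℝ) 1, HasDerivAt T (T' s) s)
    (hT'c : ContinuousOn T' (Icc 0 1))
    (hTint : (∫ s in (0:ℝ)..1, (T' s) ^ 2) ≤ Tmax)
    (hhc : ContinuousOn h (Icc 0 1))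
    (hGc : ContinuousOn G (Icc 0 1))
    (hh : ∀ s ∈ Icc (0:ℝ) 1, 0 < h s)
    (hG : ∀ s ∈ Icc (0:ℝ) 1, 0 ≤ G s) :
    |(∫ s in (0:ℝ)..1, Real.sqrt ((T' s) ^ 2 / (h s) ^ 2 + G s)) -
        ∫ s in (0:ℝ)..1, Real.sqrt ((T' s) ^ 2 * r₀ ^ 2 / 4 + G s)| ≤
      Real.sqrt Tmax *
        (∫ s in (0:ℝ)..1, |1 / (h s) ^ 2 - r₀ ^ 2 / 4| ^ 2) ^ ((1:ℝ)/4) := by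
  have h01 : (0:ℝ) ≤ 1 := zero_le_one
  have hne : ∀ s ∈ Icc (0:ℝ) 1, h s ^ 2 ≠ 0 := fun s hs => pow_ne_zero 2 (hh s hs).ne'
  set D : ℝ → ℝ := fun s => |1 / (h s) ^ 2 - r₀ ^ 2 / 4|
  have hDc : ContinuousOn D (Icc 0 1) :=
    ((continuousOn_const.div (hhc.pow 2) hne).sub continuousOn_const).abs
  have hc₁ : ContinuousOn (fun s => Real.sqrt ((T' s) ^ 2 / (h s) ^ 2 + G s)) (Icc 0 1) :=
    (((hT'c.pow 2).div (hhc.pow 2) hne).add hGc).sqrt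
  have hc₂ : ContinuousOn (fun s => Real.sqrt ((T' s) ^ 2 * r₀ ^ 2 / 4 + G s)) (Icc 0 1) :=
    ((((hT'c.pow 2).mul continuousOn_const).div_const 4).add hGc).sqrt
  have hpt : ∀ s ∈ Icc (0:ℝ) 1,
      |Real.sqrt ((T' s) ^ 2 / (h s) ^ 2 + G s) - Real.sqrt ((T' s) ^ 2 * r₀ ^ 2 / 4 + G s)| ≤
        |T' s| * Real.sqrt (D s) := by
    intro s hs
    have hGs := hG s hs
    refine (abs_sqrt_sub_sqrt_le_sqrt_abs_sub (by positivity) (by positivity)).trans_eq ?_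
    have hfac : (T' s) ^ 2 / (h s) ^ 2 + G s - ((T' s) ^ 2 * r₀ ^ 2 / 4 + G s) =
        (T' s) ^ 2 * (1 / (h s) ^ 2 - r₀ ^ 2 / 4) := by ring
    rw [hfac, abs_mul, abs_of_nonneg (sq_nonneg (T' s)), Real.sqrt_mul (sq_nonneg _),
      Real.sqrt_sq_eq_abs]
  have hDint : ∫ s in (0:ℝ)..1, D s ≤ Real.sqrt (∫ s in (0:ℝ)..1, D s ^ 2) := by
    simpa using intervalIntegral_mul_le_sqrt_mul_sqrt h01 hDc (continuousOn_const (c := (1:ℝ)))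
  have hsqrtD : ∫ s in (0:ℝ)..1, Real.sqrt (D s) ^ 2 = ∫ s in (0:ℝ)..1, D s :=
    intervalIntegral.integral_congr fun s _ => Real.sq_sqrt (abs_nonneg _)
  have hroot : Real.sqrt (Real.sqrt (∫ s in (0:ℝ)..1, D s ^ 2)) =
      (∫ s in (0:ℝ)..1, D s ^ 2) ^ ((1:ℝ)/4) := by
    rw [Real.sqrt_eq_rpow, Real.sqrt_eq_rpow, ← Real.rpow_mul
      (intervalIntegral.integral_nonneg h01 fun s _ => sq_nonneg _)]
    norm_num
  rw [← intervalIntegral.integral_sub (hc₁.intervalIntegrable_of_Icc h01)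
    (hc₂.intervalIntegrable_of_Icc h01)]
  calc _ ≤ ∫ s in (0:ℝ)..1, |Real.sqrt ((T' s) ^ 2 / (h s) ^ 2 + G s) -
          Real.sqrt ((T' s) ^ 2 * r₀ ^ 2 / 4 + G s)| :=
        intervalIntegral.abs_integral_le_integral_abs h01
    _ ≤ ∫ s in (0:ℝ)..1, |T' s| * Real.sqrt (D s) :=
        intervalIntegral.integral_mono_on h01
          ((hc₁.sub hc₂).abs.intervalIntegrable_of_Icc h01)
          ((hT'c.abs.mul hDc.sqrt).intervalIntegrable_of_Icc h01) hpt
    _ ≤ Real.sqrt (∫ s in (0:ℝ)..1, |T' s| ^ 2) *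
          Real.sqrt (∫ s in (0:ℝ)..1, Real.sqrt (D s) ^ 2) :=
        intervalIntegral_mul_le_sqrt_mul_sqrt h01 hT'c.abs hDc.sqrt
    _ ≤ Real.sqrt Tmax * Real.sqrt (Real.sqrt (∫ s in (0:ℝ)..1, D s ^ 2)) := by
        simp only [sq_abs, hsqrtD]
        gcongr
    _ = _ := by rw [hroot]
end

section
/- Let w, u, v, m, p : [0,1] → ℝ be continuous nonnegative functions satisfying |u(s) − v(s)| ≤ m(s)·p(s)² for all s ∈ [0,1]. Then |∫₀¹ √(w(s)+u(s)) ds − ∫₀¹ √(w(s)+v(s)) ds| ≤ (∫₀¹ m(s)² ds)^{1/4} · (∫₀¹ p(s)² ds)^{1/2}. -/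
open MeasureTheory Set

/-- The Cauchy–Schwarz inequality for continuous functions on a compact interval. -/
theorem sq_integral_mul_le_of_continuousOn {a b : ℝ} (hab : a ≤ b) {f g : ℝ → ℝ}
    (hf : ContinuousOn f (Icc a b)) (hg : ContinuousOn g (Icc a b)) :
    (∫ s in a..b, f s * g s) ^ 2 ≤ (∫ s in a..b, f s ^ 2) * ∫ s in a..b, g s ^ 2 := by
  have hquad (x : ℝ) : 0 ≤ (∫ s in a..b, f s ^ 2) * (x * x) +
      (2 * ∫ s in a..b, f s * g s) * x + ∫ s in a..b, g s ^ 2 := by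
    have hff : IntervalIntegrable (fun s => x * x * f s ^ 2) volume a b :=
      (continuousOn_const.mul (hf.pow 2)).intervalIntegrable_of_Icc hab
    have hfg : IntervalIntegrable (fun s => 2 * x * (f s * g s)) volume a b :=
      (continuousOn_const.mul (hf.mul hg)).intervalIntegrable_of_Icc hab
    have hgg : IntervalIntegrable (fun s => g s ^ 2) volume a b :=
      (hg.pow 2).intervalIntegrable_of_Icc hab
    calc
      0 ≤ ∫ s in a..b, (x * f s + g s) ^ 2 :=
        intervalIntegral.integral_nonneg hab fun s _ => sq_nonneg _
      _ = ∫ s in a..b, (x * x * f s ^ 2 + 2 * x * (f s * g s) + g s ^ 2) := by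
        congr 1 with s
        ring
      _ = _ := by
        rw [intervalIntegral.integral_add (hff.add hfg) hgg,
          intervalIntegral.integral_add hff hfg, intervalIntegral.integral_const_mul,
          intervalIntegral.integral_const_mul]
        ring
  have h := discrim_le_zero hquad
  rw [discrim] at h
  linarith

theorem abs_sqrt_sub_sqrt_le_sqrt_abs_sub_s1 {x y : ℝ} (hx : 0 ≤ x) (hy : 0 ≤ y) :
    |√x - √y| ≤ √|x - y| := by
  apply Real.le_sqrt_of_sq_le
  have hfactor : x - y = (√x - √y) * (√x + √y) := by
    linear_combination -Real.sq_sqrt hx + Real.sq_sqrt hy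
  rw [hfactor, abs_mul, sq]
  refine mul_le_mul_of_nonneg_left ?_ (abs_nonneg _)
  rw [abs_of_nonneg (by positivity : 0 ≤ √x + √y), abs_le]
  constructor <;> linarith [Real.sqrt_nonneg x, Real.sqrt_nonneg y]

/-- Analytic core of Lemma `IMCF-L-Sigma`: comparing integrals of square roots
whose arguments differ by a controlled amount. -/
theorem imcf_length_comparison_sigma
    (w u v m p : ℝ → ℝ)
    (hwc : ContinuousOn w (Icc 0 1)) (huc : ContinuousOn u (Icc 0 1))
    (hvc : ContinuousOn v (Icc 0 1)) (hmc : ContinuousOn m (Icc 0 1))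
    (hpc : ContinuousOn p (Icc 0 1))
    (hw : ∀ s ∈ Icc (0:ℝ) 1, 0 ≤ w s) (hu : ∀ s ∈ Icc (0:ℝ) 1, 0 ≤ u s)
    (hv : ∀ s ∈ Icc (0:ℝ) 1, 0 ≤ v s) (hm : ∀ s ∈ Icc (0:ℝ) 1, 0 ≤ m s)
    (hp : ∀ s ∈ Icc (0:ℝ) 1, 0 ≤ p s)
    (hbound : ∀ s ∈ Icc (0:ℝ) 1, |u s - v s| ≤ m s * (p s) ^ 2) :
    |(∫ s in (0:ℝ)..1, Real.sqrt (w s + u s)) -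
        ∫ s in (0:ℝ)..1, Real.sqrt (w s + v s)| ≤
      (∫ s in (0:ℝ)..1, (m s) ^ 2) ^ ((1:ℝ)/4) *
        (∫ s in (0:ℝ)..1, (p s) ^ 2) ^ ((1:ℝ)/2) := by
  have h01 : (0 : ℝ) ≤ 1 := zero_le_one
  have hsm : ContinuousOn (fun s => √(m s)) (Icc 0 1) := hmc.sqrt
  have hu_int : IntervalIntegrable (fun s => √(w s + u s)) volume 0 1 :=
    (hwc.add huc).sqrt.intervalIntegrable_of_Icc h01
  have hv_int : IntervalIntegrable (fun s => √(w s + v s)) volume 0 1 :=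
    (hwc.add hvc).sqrt.intervalIntegrable_of_Icc h01
  have hpoint : ∀ s ∈ Icc (0 : ℝ) 1, |√(w s + u s) - √(w s + v s)| ≤ √(m s) * p s := by
    intro s hs
    calc
      |√(w s + u s) - √(w s + v s)| ≤ √|w s + u s - (w s + v s)| :=
        abs_sqrt_sub_sqrt_le_sqrt_abs_sub_s1 (add_nonneg (hw s hs) (hu s hs))
          (add_nonneg (hw s hs) (hv s hs))
      _ ≤ √(m s * p s ^ 2) := by
        rw [add_sub_add_left_eq_sub]
        exact Real.sqrt_le_sqrt (hbound s hs)
      _ = √(m s) * p s := by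
        rw [Real.sqrt_mul (hm s hs), Real.sqrt_sq (hp s hs)]
  have hmp := sq_integral_mul_le_of_continuousOn h01 hsm hpc
  rw [intervalIntegral.integral_congr (g := m) fun s hs =>
    Real.sq_sqrt (hm s (by rwa [uIcc_of_le h01] at hs))] at hmp
  have hm1 : (∫ s in (0 : ℝ)..1, m s) ^ 2 ≤ ∫ s in (0 : ℝ)..1, m s ^ 2 := by
    simpa using sq_integral_mul_le_of_continuousOn h01 hmc
      (continuousOn_const (c := (1 : ℝ)))
  have hp2 : 0 ≤ ∫ s in (0 : ℝ)..1, p s ^ 2 :=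
    intervalIntegral.integral_nonneg h01 fun s _ => sq_nonneg _
  have hm2 : 0 ≤ ∫ s in (0 : ℝ)..1, m s ^ 2 :=
    intervalIntegral.integral_nonneg h01 fun s _ => sq_nonneg _
  have hfourth : (∫ s in (0 : ℝ)..1, m s ^ 2) ^ ((1 : ℝ) / 4) =
      √√(∫ s in (0 : ℝ)..1, m s ^ 2) := by
    rw [Real.sqrt_eq_rpow, Real.sqrt_eq_rpow, ← Real.rpow_mul hm2]
    norm_num
  rw [hfourth, ← Real.sqrt_eq_rpow, ← Real.sqrt_mul (Real.sqrt_nonneg _),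
    ← intervalIntegral.integral_sub hu_int hv_int]
  calc
    |∫ s in (0 : ℝ)..1, (√(w s + u s) - √(w s + v s))|
        ≤ ∫ s in (0 : ℝ)..1, |√(w s + u s) - √(w s + v s)| :=
      intervalIntegral.abs_integral_le_integral_abs h01
    _ ≤ ∫ s in (0 : ℝ)..1, √(m s) * p s :=
      intervalIntegral.integral_mono_on h01 (hu_int.sub hv_int).abs
        ((hsm.mul hpc).intervalIntegrable_of_Icc h01) hpoint
    _ ≤ √((∫ s in (0 : ℝ)..1, m s) * ∫ s in (0 : ℝ)..1, p s ^ 2) :=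
      Real.le_sqrt_of_sq_le hmp
    _ ≤ √(√(∫ s in (0 : ℝ)..1, m s ^ 2) * ∫ s in (0 : ℝ)..1, p s ^ 2) := by
      gcongr
      exact Real.le_sqrt_of_sq_le hm1
end
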